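/- Let X^k = {x_i^k} be a classical solution of the penalized system ẋ_i^k(t) = F_i(t, X^k(t)) − k(d∇d)(x_i^k(t)) with k > ‖F‖_∞/ε, fix i and ψ ∈ C_c^∞((0,T); ℝ^m), let I_k := {t ∈ [0,T] : x_i^k(t) ∉ cl Ω}, and set A_k := ∫_{I_k} (d/dt d(x_i^k(t))) ∇d(x_i^k(t))·ψ(t) dt. Then there exists a constant C > 0 (depending on ψ, Ω and ‖F‖_∞, but not on k) such that |A_k| ≤ C T ‖F‖_∞ / k; in particular A_k → 0 as k → ∞. -/

import Mathlib

open Set MeasureTheory Filter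
open scoped RealInnerProductSpace Topology NNReal ContDiff

noncomputable section

/-- Points of `ℝ^m`. -/
abbrev Pt (m : ℕ) := EuclideanSpace ℝ (Fin m)

/-- Configurations of `n` particles in `ℝ^m`, equipped with the sup-norm
`‖X‖ = max_i |x_i|`. -/
abbrev Conf (m n : ℕ) := Fin n → Pt m

variable {m n : ℕ}

open Classical in
/-- Signed distance function with respect to the boundary of `Ω`:
nonpositive on `cl Ω`, positive outside. -/
def sgnDist (Ω : Set (Pt m)) (x : Pt m) : ℝ :=
  if x ∈ closure Ω then -Metric.infDist x (frontier Ω) else Metric.infDist x (frontier Ω)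

/-- `Ω ⊆ ℝ^m` is a nonempty bounded open domain with `C²` boundary and outward
unit normal field `ν`: the signed distance function is `C²` near each boundary
point, and its gradient on the boundary is the outward unit normal `ν`. -/
structure IsC2Domain (Ω : Set (Pt m)) (ν : Pt m → Pt m) : Prop where
  isOpen : IsOpen Ω
  nonempty : Ω.Nonempty
  bounded : Bornology.IsBounded Ω
  smoothBoundary : ∀ x ∈ frontier Ω, ContDiffAt ℝ 2 (sgnDist Ω) x
  grad_eq_normal : ∀ x ∈ frontier Ω, gradient (sgnDist Ω) x = ν x
  normal_unit : ∀ x ∈ frontier Ω, ‖ν x‖ = 1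

open Classical in
/-- The one-sided projection `P(x,f)`: if `x ∈ ∂Ω` and `f · ν(x) > 0` then
`P(x,f) = f - (f·ν(x)) ν(x)`, otherwise `P(x,f) = f`. -/
def oneProj (Ω : Set (Pt m)) (ν : Pt m → Pt m) (x f : Pt m) : Pt m :=
  if x ∈ frontier Ω ∧ 0 < ⟪f, ν x⟫ then f - ⟪f, ν x⟫ • ν x else f

/-- The set `G = (cl Ω)^n` of admissible configurations. -/
def Gset (Ω : Set (Pt m)) (n : ℕ) : Set (Conf m n) := {X | ∀ i, X i ∈ closure Ω}

/-- Mild solution of the confined particle system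
`ẋ_i = H_i(t, X) = P(x_i, F_i(t,X))` on `[0,T]` with initial condition `X0`:
each `x_i` is continuous, stays in `cl Ω` and satisfies
`x_i(t) = x_i(0) + ∫₀ᵗ H_i(s, X(s)) ds`. -/
def IsMildSol (Ω : Set (Pt m)) (ν : Pt m → Pt m) (F : Fin n → ℝ → Conf m n → Pt m)
    (T : ℝ) (X0 : Conf m n) (X : ℝ → Conf m n) : Prop :=
  (∀ i, ContinuousOn (fun t => X t i) (Icc 0 T)) ∧
  (∀ t ∈ Icc (0:ℝ) T, ∀ i, X t i ∈ closure Ω) ∧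
  (∀ t ∈ Icc (0:ℝ) T, ∀ i,
    X t i = X0 i + ∫ s in (0:ℝ)..t, oneProj Ω ν (X s i) (F i s (X s)))

/-- The distance function `d(x) = dist(x, cl Ω)`. -/
def distCl (Ω : Set (Pt m)) (x : Pt m) : ℝ := Metric.infDist x (closure Ω)

open Classical in
/-- The function `d ∇d`, extended by `0` on `cl Ω`. -/
def dGradd (Ω : Set (Pt m)) (x : Pt m) : Pt m :=
  if x ∈ closure Ω then 0 else distCl Ω x • gradient (distCl Ω) x

/-- Classical solution of the penalized system
`ẋ_i(t) = F_i(t, X(t)) - k (d∇d)(x_i(t))` on `[0,T]`. -/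
def IsPenalSol (Ω : Set (Pt m)) (F : Fin n → ℝ → Conf m n → Pt m)
    (T k : ℝ) (X0 : Conf m n) (X : ℝ → Conf m n) : Prop :=
  X 0 = X0 ∧
  ∀ i, ∀ t ∈ Icc (0:ℝ) T,
    HasDerivWithinAt (fun s => X s i) (F i t (X t) - k • dGradd Ω (X t i)) (Icc 0 T) t

/-- Admissible configurations with pairwise distinct particle positions. -/
def Gstar (Ω : Set (Pt m)) (n : ℕ) : Set (Conf m n) :=
  {X | (∀ i, X i ∈ closure Ω) ∧ ∀ i j, i ≠ j → X i ≠ X j}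

/-- The particle interaction energy
`E(X) = (1/(n(n-1))) Σ_{j<i} V(x_i - x_j) + (1/n) Σ_i W(x_i)`. -/
def energy (V W : Pt m → ℝ) (X : Conf m n) : ℝ :=
  (1 / ((n : ℝ) * ((n : ℝ) - 1))) *
      ∑ i : Fin n, ∑ j ∈ Finset.filter (fun j => j < i) Finset.univ, V (X i - X j) +
    (1 / (n : ℝ)) * ∑ i : Fin n, W (X i)

/-- The gradient `∇_{x_i} E(X)` of the energy with respect to particle `i`. -/
def Egrad (V W : Pt m → ℝ) (i : Fin n) (X : Conf m n) : Pt m :=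
  gradient (fun y => energy V W (Function.update X i y)) (X i)

theorem core_ibp (T : ℝ) (hT : 0 < T) (J : Set ℝ) (hJo : IsOpen J) (hJ : J ⊆ Ioo 0 T)
    (δ δ' g g' : ℝ → ℝ) (D L P Q : ℝ) (hQ : 0 ≤ Q) (hD : 0 ≤ D)
    (hδ0 : ∀ t, 0 ≤ δ t) (hδp : ∀ t ∈ J, 0 < δ t) (hδD : ∀ t ∈ J, δ t ≤ D)
    (hδ : ∀ t ∈ J, HasDerivAt δ (δ' t) t) (hg : ∀ t ∈ J, HasDerivAt g (g' t) t)
    (hδc : ContinuousOn δ' J) (hgc : ContinuousOn g' J)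
    (hδL : ∀ t ∈ J, |δ' t| ≤ L) (hgP : ∀ t, |g t| ≤ P) (hgQ : ∀ t ∈ J, |g' t| ≤ Q)
    (hz : ∀ t ∈ Ioo 0 T, t ∉ J → δ t = 0 ∧ δ =O[𝓝 t] (fun s => s - t))
    (hg0 : g =ᶠ[𝓝 0] 0) (hgT : g =ᶠ[𝓝 T] 0) :
    |∫ t in J, δ' t * g t| ≤ T * D * Q := by
  have hJm := hJo.measurableSet
  have hP : 0 ≤ P := (abs_nonneg _).trans (hgP 0)
  have hvol : volume J ≤ ENNReal.ofReal T := by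
    have := measure_mono (μ := volume) hJ
    simpa using this
  have hfin : volume J < ⊤ := hvol.trans_lt ENNReal.ofReal_lt_top
  have hreal : volume.real J ≤ T := by
    rw [Measure.real]
    exact ENNReal.toReal_le_of_le_ofReal hT.le hvol
  have : IsFiniteMeasure (volume.restrict J) := ⟨by simpa using hfin⟩
  have hδcont : ContinuousOn δ J := fun t ht => (hδ t ht).continuousAt.continuousWithinAt
  have hgcont : ContinuousOn g J := fun t ht => (hg t ht).continuousAt.continuousWithinAt
  -- bound for each η
  have key : ∀ η : ℝ, 0 < η →
      |∫ t in J, (δ t ^ 2 + 2 * δ t * η) / (δ t + η) ^ 2 * (δ' t * g t)| ≤ T * D * Q := by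
    intro η hη
    have hne : ∀ t, δ t + η ≠ 0 := fun t => by have := hδ0 t; positivity
    set u : ℝ → ℝ := fun t => (δ t ^ 2 + 2 * δ t * η) / (δ t + η) ^ 2 * (δ' t * g t) with hu
    set v : ℝ → ℝ := fun t => δ t ^ 2 / (δ t + η) * g' t with hv
    have huc : ContinuousOn u J := by
      apply ContinuousOn.mul
      · apply ContinuousOn.div (by fun_prop) (by fun_prop)
        intro t _; exact pow_ne_zero _ (hne t)
      · exact hδc.mul hgcont
    have hvc : ContinuousOn v J := by
      apply ContinuousOn.mul _ hgc
      apply ContinuousOn.div (by fun_prop) (by fun_prop)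
      intro t _; exact hne t
    have hφ1 : ∀ t, |(δ t ^ 2 + 2 * δ t * η) / (δ t + η) ^ 2| ≤ 1 := by
      intro t
      have := hδ0 t
      rw [abs_of_nonneg (by positivity), div_le_one (by positivity)]
      nlinarith
    have hub : ∀ t ∈ J, ‖u t‖ ≤ L * P := by
      intro t ht
      rw [Real.norm_eq_abs, hu]
      simp only [abs_mul]
      have h1 := hδL t ht
      have h2 := hgP t
      calc _ ≤ 1 * (L * P) := by
            have := hφ1 t
            gcongr
            exact (abs_nonneg _).trans h1
        _ = _ := by ring
    have hvb : ∀ t ∈ J, ‖v t‖ ≤ D * Q := by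
      intro t ht
      rw [Real.norm_eq_abs, hv]
      simp only [abs_mul]
      have h0 := hδ0 t
      have h1 : |δ t ^ 2 / (δ t + η)| ≤ D := by
        rw [abs_of_nonneg (by positivity), div_le_iff₀ (by positivity)]
        nlinarith [hδD t ht]
      have h2 := hgQ t ht
      gcongr
    have hui : IntegrableOn u J := by
      refine Integrable.of_bound (huc.aestronglyMeasurable hJm) (L * P) ?_
      exact (ae_restrict_iff' hJm).2 (ae_of_all _ hub)
    have hvi : IntegrableOn v J := by
      refine Integrable.of_bound (hvc.aestronglyMeasurable hJm) (D * Q) ?_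
      exact (ae_restrict_iff' hJm).2 (ae_of_all _ hvb)
    set h : ℝ → ℝ := fun t => δ t ^ 2 / (δ t + η) * g t with hh
    have hderiv : ∀ t ∈ Ioo 0 T, HasDerivAt h (J.indicator (u + v) t) t := by
      intro t ht
      by_cases htJ : t ∈ J
      · rw [indicator_of_mem htJ]
        have h1 := ((((hδ t htJ).pow 2).div ((hδ t htJ).add_const η) (hne t)).mul (hg t htJ))
        refine h1.congr_deriv ?_
        change _ = (δ t ^ 2 + 2 * δ t * η) / (δ t + η) ^ 2 * (δ' t * g t)
          + δ t ^ 2 / (δ t + η) * g' t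
        simp only [Pi.pow_apply, Pi.div_apply]
        have := hne t
        field_simp
        push_cast
        ring
      · rw [indicator_of_notMem htJ]
        obtain ⟨hz1, hz2⟩ := hz t ht htJ
        rw [hasDerivAt_iff_isLittleO]
        have hht : h t = 0 := by simp [hh, hz1]
        have e1 : h =O[𝓝 t] (fun s => δ s ^ 2) := by
          refine Asymptotics.IsBigO.of_bound (P / η) (Eventually.of_forall fun s => ?_)
          have h0 := hδ0 s
          have h2 := hgP s
          rw [hh]
          simp only [norm_mul, norm_div, Real.norm_eq_abs]
          rw [abs_of_nonneg (by positivity : 0 ≤ δ s + η)]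
          calc |δ s ^ 2| / (δ s + η) * |g s| ≤ |δ s ^ 2| / η * P := by
                gcongr
                linarith
            _ = _ := by ring
        have e2 := e1.trans (hz2.pow 2)
        have e3 : (fun s => (s - t) ^ 2) =o[𝓝 t] (fun s => s - t) := by
          have : (fun s : ℝ => (s - t)) =o[𝓝 t] (fun _ => (1:ℝ)) := by
            rw [Asymptotics.isLittleO_one_iff]
            have : ContinuousAt (fun s : ℝ => s - t) t := by fun_prop
            simpa [ContinuousAt] using this
          simpa [pow_two] using this.mul_isBigO (Asymptotics.isBigO_refl (fun s : ℝ => s - t) (𝓝 t))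
        simpa [hht] using e2.trans_isLittleO e3
    have hend : ∀ a, g =ᶠ[𝓝 a] 0 → ContinuousAt h a ∧ h a = 0 := by
      intro a ha
      have : h =ᶠ[𝓝 a] fun _ => 0 := by
        filter_upwards [ha] with s hs
        simp [hh, hs]
      exact ⟨continuousAt_const.congr this.symm, this.eq_of_nhds⟩
    have hcont : ContinuousOn h (Icc 0 T) := by
      intro t ht
      apply ContinuousAt.continuousWithinAt
      rcases eq_or_lt_of_le ht.1 with e | e
      · rw [← e]; exact (hend 0 hg0).1
      rcases eq_or_lt_of_le ht.2 with e' | e'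
      · rw [e']; exact (hend T hgT).1
      exact (hderiv t ⟨e, e'⟩).continuousAt
    have hint : Integrable (J.indicator (u + v)) := (hui.add hvi).integrable_indicator hJm
    have ftc := intervalIntegral.integral_eq_sub_of_hasDerivAt_of_le hT.le hcont hderiv
      hint.intervalIntegrable
    rw [(hend 0 hg0).2, (hend T hgT).2, sub_zero, intervalIntegral.integral_of_le hT.le,
      setIntegral_indicator hJm, inter_eq_self_of_subset_right (hJ.trans Ioo_subset_Ioc_self)] at ftc
    have ftc2 : (∫ t in J, u t) + ∫ t in J, v t = 0 := by
      rw [← integral_add hui hvi]; exact ftc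
    rw [eq_neg_of_add_eq_zero_left ftc2, abs_neg, ← Real.norm_eq_abs]
    calc _ ≤ D * Q * volume.real J := norm_setIntegral_le_of_norm_le_const hfin hvb
      _ ≤ D * Q * T := by gcongr
      _ = _ := by ring
  have lim : Tendsto (fun η : ℝ => ∫ t in J, (δ t ^ 2 + 2 * δ t * η) / (δ t + η) ^ 2 * (δ' t * g t))
      (𝓝[>] 0) (𝓝 (∫ t in J, δ' t * g t)) := by
    refine tendsto_integral_filter_of_dominated_convergence (fun _ => L * P) ?_ ?_ ?_ ?_
    · filter_upwards [self_mem_nhdsWithin] with η hη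
      refine ContinuousOn.aestronglyMeasurable ?_ hJm
      apply ContinuousOn.mul
      · apply ContinuousOn.div (by fun_prop) (by fun_prop)
        intro t _
        have := hδ0 t
        have : 0 < η := hη
        positivity
      · exact hδc.mul hgcont
    · filter_upwards [self_mem_nhdsWithin] with η hη
      refine (ae_restrict_iff' hJm).2 (ae_of_all _ fun t ht => ?_)
      have hη : 0 < η := hη
      have h0 := hδ0 t
      have h1 := hδL t ht
      have h2 := hgP t
      have h3 : |(δ t ^ 2 + 2 * δ t * η) / (δ t + η) ^ 2| ≤ 1 := by
        rw [abs_of_nonneg (by positivity), div_le_one (by positivity)]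
        nlinarith
      rw [Real.norm_eq_abs]
      simp only [abs_mul]
      calc _ ≤ 1 * (L * P) := by
            gcongr
            exact (abs_nonneg _).trans h1
        _ = _ := by ring
    · exact integrable_const _
    · refine (ae_restrict_iff' hJm).2 (ae_of_all _ fun t ht => ?_)
      have hp := hδp t ht
      have : ContinuousAt (fun η : ℝ => (δ t ^ 2 + 2 * δ t * η) / (δ t + η) ^ 2 * (δ' t * g t)) 0 := by
        apply ContinuousAt.mul _ continuousAt_const
        apply ContinuousAt.div (by fun_prop) (by fun_prop)
        simp [hp.ne']
      have h2 := this.tendsto.mono_left (nhdsWithin_le_nhds (s := Ioi 0))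
      simpa [hp.ne'] using h2
  exact le_of_tendsto lim.abs (by filter_upwards [self_mem_nhdsWithin] with η hη using key η hη)

theorem distCl_lip {m : ℕ} (Ω : Set (Pt m)) : LipschitzWith 1 (distCl Ω) :=
  Metric.lipschitz_infDist_pt _

theorem norm_fderiv_distCl_le {m : ℕ} (Ω : Set (Pt m)) (x : Pt m) :
    ‖fderiv ℝ (distCl Ω) x‖ ≤ 1 := by
  simpa using norm_fderiv_le_of_lipschitz ℝ (x₀ := x) (distCl_lip Ω)

theorem norm_gradient_eq {m : ℕ} (f : Pt m → ℝ) (x : Pt m) :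
    ‖gradient f x‖ = ‖fderiv ℝ f x‖ := by
  simp [gradient]

theorem inner_gradient_eq {m : ℕ} (f : Pt m → ℝ) (x v : Pt m) :
    ⟪gradient f x, v⟫ = fderiv ℝ f x v := by
  simp [gradient]

theorem norm_gradient_distCl {m : ℕ} (Ω : Set (Pt m)) (hne : Ω.Nonempty) (x : Pt m)
    (hx : x ∉ closure Ω) (hd : DifferentiableAt ℝ (distCl Ω) x) :
    ‖gradient (distCl Ω) x‖ = 1 := by
  rw [norm_gradient_eq]
  refine le_antisymm (norm_fderiv_distCl_le Ω x) ?_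
  obtain ⟨p, hp, hpd⟩ := isClosed_closure.exists_infDist_eq_dist hne.closure x
  set e := p - x with he
  have hepos : 0 < ‖e‖ := by
    rw [norm_pos_iff, he, sub_ne_zero]
    rintro rfl; exact hx hp
  have hdx : distCl Ω x = ‖e‖ := by
    rw [distCl, hpd, dist_comm, dist_eq_norm]
  have hline : HasDerivAt (fun s : ℝ => distCl Ω (x + s • e)) (fderiv ℝ (distCl Ω) x e) 0 := by
    have h1 : HasDerivAt (fun s : ℝ => x + s • e) e 0 := by
      simpa using ((hasDerivAt_id (0:ℝ)).smul_const e).const_add x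
    have h2 : HasFDerivAt (distCl Ω) (fderiv ℝ (distCl Ω) x) (x + (0:ℝ) • e) := by
      simpa using hd.hasFDerivAt
    exact h2.comp_hasDerivAt (0:ℝ) h1
  have hslope := hline.tendsto_slope_zero_right
  have hle : fderiv ℝ (distCl Ω) x e ≤ -‖e‖ := by
    refine le_of_tendsto hslope ?_
    filter_upwards [Ioo_mem_nhdsGT (zero_lt_one (α := ℝ))] with s hs
    have h3 : distCl Ω (x + s • e) ≤ (1 - s) * ‖e‖ := by
      have : dist (x + s • e) p = (1 - s) * ‖e‖ := by
        rw [dist_comm, dist_eq_norm]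
        have : p - (x + s • e) = (1 - s) • e := by rw [sub_smul, one_smul, he]; abel
        rw [this, norm_smul, Real.norm_of_nonneg (by linarith [hs.2])]
      rw [← this]
      exact Metric.infDist_le_dist_of_mem hp
    have hs0 := hs.1
    simp only [zero_add, zero_smul, add_zero, smul_eq_mul]
    rw [inv_mul_le_iff₀ hs0, hdx]
    linarith
  have h4 := (fderiv ℝ (distCl Ω) x).le_opNorm e
  have h5 := neg_abs_le (fderiv ℝ (distCl Ω) x e)
  rw [Real.norm_eq_abs] at h4
  by_contra! hcon
  nlinarith

theorem norm_fderiv2_eq {m : ℕ} (f : Pt m → ℝ) (z : Pt m) :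
    ‖fderiv ℝ (fderiv ℝ f) z‖ = ‖iteratedFDeriv ℝ 2 f z‖ := by
  rw [← norm_iteratedFDeriv_fderiv, norm_iteratedFDeriv_one]

theorem hess_bound {m : ℕ} (Ω : Set (Pt m)) (hΩo : IsOpen Ω) (hΩb : Bornology.IsBounded Ω)
    (ε : ℝ) (hε : 0 < ε)
    (hd1 : ContDiffOn ℝ 2 (distCl Ω) (closure (Metric.thickening ε (frontier Ω)) \ Ω))
    (hd2 : ∀ x ∈ closure (Metric.thickening ε Ω) \ closure Ω,
      ContDiffAt ℝ 2 (distCl Ω) x) :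
    ∃ B : ℝ, 0 ≤ B ∧ ∀ z ∈ Metric.thickening ε Ω, z ∉ closure Ω →
      ‖fderiv ℝ (fderiv ℝ (distCl Ω)) z‖ ≤ B := by
  have hK : IsCompact (closure (Metric.thickening ε Ω) \ Ω) := by
    refine IsCompact.diff ?_ hΩo
    exact Metric.isCompact_of_isClosed_isBounded isClosed_closure hΩb.thickening.closure
  have hloc : ∀ y ∈ closure (Metric.thickening ε Ω) \ Ω, ∃ B : ℝ, ∀ᶠ z in 𝓝 y,
      z ∉ closure Ω → ‖fderiv ℝ (fderiv ℝ (distCl Ω)) z‖ ≤ B := by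
    intro y hy
    by_cases hyc : y ∈ closure Ω
    · have hyf : y ∈ frontier Ω := by
        rw [hΩo.frontier_eq]; exact ⟨hyc, hy.2⟩
      set K := closure (Metric.thickening ε (frontier Ω)) \ Ω with hKdef
      have hyt : y ∈ Metric.thickening ε (frontier Ω) :=
        Metric.self_subset_thickening hε _ hyf
      have hyK : y ∈ K := ⟨subset_closure hyt, hy.2⟩
      obtain ⟨u, hu, p, hp⟩ := (hd1 y hyK) 2 (by norm_num)
      rw [insert_eq_of_mem hyK] at hu
      have hyu : y ∈ u := mem_of_mem_nhdsWithin hyK hu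
      have hpc := (hp.cont 2 (by norm_num)) y hyu
      have hb : ∀ᶠ z in 𝓝[u] y, ‖p z 2‖ < ‖p y 2‖ + 1 :=
        hpc.norm.eventually_lt continuousWithinAt_const (by linarith)
      obtain ⟨V, hVo, hyV, hV⟩ := mem_nhdsWithin.1 hu
      obtain ⟨V', hVo', hyV', hV'⟩ := mem_nhdsWithin.1 hb
      refine ⟨‖p y 2‖ + 1, ?_⟩
      filter_upwards [hVo.mem_nhds hyV, hVo'.mem_nhds hyV',
        Metric.isOpen_thickening.mem_nhds hyt] with z h1 h2 h3 hz
      set O := V ∩ Metric.thickening ε (frontier Ω) ∩ (closure Ω)ᶜ with hO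
      have hOo : IsOpen O :=
        (hVo.inter Metric.isOpen_thickening).inter isClosed_closure.isOpen_compl
      have hOu : O ⊆ u := fun w hw =>
        hV ⟨hw.1.1, subset_closure hw.1.2, fun h => hw.2 (subset_closure h)⟩
      have hzO : z ∈ O := ⟨⟨h1, h3⟩, hz⟩
      have e1 := (hp.mono hOu).eq_iteratedFDerivWithin_of_uniqueDiffOn (m := 2) (by norm_num)
        hOo.uniqueDiffOn hzO
      rw [iteratedFDerivWithin_of_isOpen 2 hOo hzO] at e1
      rw [norm_fderiv2_eq, ← e1]
      exact (hV' ⟨h2, hOu hzO⟩ : ‖p z 2‖ < _).le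
    · have h1 : ContDiffAt ℝ 2 (distCl Ω) y := hd2 y ⟨hy.1, hyc⟩
      have h2 : ContinuousAt (fderiv ℝ (fderiv ℝ (distCl Ω))) y :=
        ((h1.fderiv_right (m := 1) (by norm_num)).fderiv_right (m := 0) (by norm_num)).continuousAt
      refine ⟨‖fderiv ℝ (fderiv ℝ (distCl Ω)) y‖ + 1, ?_⟩
      have hn : ContinuousAt (fun z => ‖fderiv ℝ (fderiv ℝ (distCl Ω)) z‖) y :=
        ContinuousAt.comp
          (continuous_norm (E := Pt m →L[ℝ] Pt m →L[ℝ] ℝ)).continuousAt h2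
      have := hn.tendsto.eventually_lt_const
        (by linarith : ‖fderiv ℝ (fderiv ℝ (distCl Ω)) y‖ < ‖fderiv ℝ (fderiv ℝ (distCl Ω)) y‖ + 1)
      filter_upwards [this] with z hz _ using hz.le
  have := hK.induction_on (p := fun s => ∃ B : ℝ, ∀ z ∈ s, z ∉ closure Ω →
      ‖fderiv ℝ (fderiv ℝ (distCl Ω)) z‖ ≤ B) ⟨0, by simp⟩
    (fun s t hst ⟨B, hB⟩ => ⟨B, fun z hz => hB z (hst hz)⟩)
    (fun s t ⟨B, hB⟩ ⟨B', hB'⟩ => ⟨max B B', fun z hz hz' => by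
      rcases hz with h | h
      · exact (hB z h hz').trans (le_max_left _ _)
      · exact (hB' z h hz').trans (le_max_right _ _)⟩)
    (fun y hy => by
      obtain ⟨B, hB⟩ := hloc y hy
      exact ⟨_, mem_nhdsWithin_of_mem_nhds hB, B, fun z hz => hz⟩)
  obtain ⟨B, hB⟩ := this
  refine ⟨max B 0, le_max_right _ _, fun z hz hz' => ?_⟩
  exact (hB z ⟨subset_closure hz, fun h => hz' (subset_closure h)⟩ hz').trans (le_max_left _ _)

theorem mem_thick {m : ℕ} (Ω : Set (Pt m)) (hne : Ω.Nonempty) (ε : ℝ) (x : Pt m)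
    (h : distCl Ω x < ε) : x ∈ Metric.thickening ε Ω := by
  rw [distCl, Metric.infDist_closure] at h
  obtain ⟨y, hy, hxy⟩ := (Metric.infDist_lt_iff hne).1 h
  exact Metric.mem_thickening_iff.2 ⟨y, hy, hxy⟩

theorem distCl_nonneg {m : ℕ} (Ω : Set (Pt m)) (x : Pt m) : 0 ≤ distCl Ω x :=
  Metric.infDist_nonneg

theorem distCl_pos {m : ℕ} (Ω : Set (Pt m)) (hne : Ω.Nonempty) (x : Pt m) :
    0 < distCl Ω x ↔ x ∉ closure Ω := by
  rw [distCl, ← isClosed_closure.notMem_iff_infDist_pos hne.closure]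

/-- The particle never gets further than `M / k`. -/
theorem penal_bound {m : ℕ} (Ω : Set (Pt m)) (hne : Ω.Nonempty) (ε : ℝ)
    (hd2 : ∀ x ∈ Metric.thickening ε Ω, x ∉ closure Ω → DifferentiableAt ℝ (distCl Ω) x)
    (T k M : ℝ) (hk : 0 < k) (hMk : M / k < ε) (x : ℝ → Pt m) (f : ℝ → Pt m)
    (hf : ∀ t ∈ Icc (0:ℝ) T, ‖f t‖ ≤ M) (hx0 : x 0 ∈ closure Ω)
    (hx : ∀ t ∈ Icc (0:ℝ) T, HasDerivWithinAt x (f t - k • dGradd Ω (x t)) (Icc 0 T) t) :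
    ∀ t ∈ Icc (0:ℝ) T, distCl Ω (x t) ≤ M / k := by
  intro t₁ ht₁
  by_contra! hcon
  have hM : 0 ≤ M := (norm_nonneg _).trans (hf t₁ ht₁)
  obtain ⟨c, hc1, hc2⟩ := exists_between (lt_min hcon hMk)
  have hc2' := lt_of_lt_of_le hc2 (min_le_left _ _)
  have hcε := lt_of_lt_of_le hc2 (min_le_right _ _)
  have hcpos : 0 < c := lt_of_le_of_lt (by positivity) hc1
  set δ : ℝ → ℝ := fun t => distCl Ω (x t) with hδ
  have hδc : ContinuousOn δ (Icc 0 T) := (distCl_lip Ω).continuous.comp_continuousOn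
    (fun t ht => (hx t ht).continuousWithinAt)
  have hδ0 : δ 0 = 0 := Metric.infDist_zero_of_mem hx0
  have hsub : Icc 0 t₁ ⊆ Icc 0 T := Icc_subset_Icc_right ht₁.2
  have hSc : IsCompact {t ∈ Icc 0 t₁ | δ t = c} := by
    have := (hδc.mono hsub).preimage_isClosed_of_isClosed isClosed_Icc (isClosed_singleton (x := c))
    exact isCompact_Icc.of_isClosed_subset this inter_subset_left
  have hSn : {t ∈ Icc 0 t₁ | δ t = c}.Nonempty := by
    obtain ⟨s, hs, hsc⟩ := intermediate_value_Icc ht₁.1 (hδc.mono hsub)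
      (⟨by rw [hδ0]; exact hcpos.le, hc2'.le⟩ : c ∈ Icc (δ 0) (δ t₁))
    exact ⟨s, hs, hsc⟩
  obtain ⟨s, ⟨hs, hsc⟩, hmin⟩ := hSc.exists_isLeast hSn
  have hsT := hsub hs
  have hs0 : 0 < s := by
    rcases eq_or_lt_of_le hs.1 with h | h
    · rw [← h, hδ0] at hsc; exact absurd hsc hcpos.ne
    · exact h
  have hnc : x s ∉ closure Ω := (distCl_pos Ω hne _).1 (by
    change 0 < δ s
    rw [hsc]; exact hcpos)
  have hthick : x s ∈ Metric.thickening ε Ω := mem_thick Ω hne ε _ (by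
    change δ s < ε
    rw [hsc]; exact hcε)
  have hdiff := hd2 _ hthick hnc
  have hder : HasDerivWithinAt δ (fderiv ℝ (distCl Ω) (x s) (f s - k • dGradd Ω (x s)))
      (Icc 0 T) s := hdiff.hasFDerivAt.comp_hasDerivWithinAt s (hx s hsT)
  have hneg : fderiv ℝ (distCl Ω) (x s) (f s - k • dGradd Ω (x s)) < 0 := by
    rw [map_sub, map_smul, dGradd, if_neg hnc, map_smul, ← inner_gradient_eq,
      ← inner_gradient_eq (distCl Ω) (x s) (gradient _ _), real_inner_self_eq_norm_sq,
      norm_gradient_distCl Ω hne _ hnc hdiff]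
    have h1 := real_inner_le_norm (gradient (distCl Ω) (x s)) (f s)
    rw [norm_gradient_distCl Ω hne _ hnc hdiff] at h1
    have h2 := hf s hsT
    have h3 : distCl Ω (x s) = c := hsc
    rw [h3]
    rw [div_lt_iff₀ hk] at hc1
    simp only [smul_eq_mul]
    nlinarith
  have hev : ∀ᶠ u in 𝓝[<] s, slope δ s u < 0 := by
    have h1 := (hasDerivWithinAt_iff_tendsto_slope.1 hder)
    have h2 : 𝓝[<] s ≤ 𝓝[Icc 0 T \ {s}] s := by
      rw [← nhdsWithin_Ioo_eq_nhdsLT hs0]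
      exact nhdsWithin_mono _ fun u hu =>
        ⟨⟨hu.1.le, hu.2.le.trans hsT.2⟩, hu.2.ne⟩
    exact (h1.mono_left h2).eventually_lt_const hneg
  obtain ⟨u, hu, hu2⟩ := (hev.and (Ioo_mem_nhdsLT hs0)).exists
  have huc : c < δ u := by
    rw [slope_def_field, hsc] at hu
    by_contra! h
    have : 0 ≤ (δ u - c) / (u - s) :=
      div_nonneg_of_nonpos (by linarith) (by linarith [hu2.2])
    linarith
  have husub : Icc 0 u ⊆ Icc 0 T := Icc_subset_Icc_right (hu2.2.le.trans hsT.2)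
  obtain ⟨w, hw, hwc⟩ := intermediate_value_Icc hu2.1.le (hδc.mono husub)
      (⟨by rw [hδ0]; exact hcpos.le, huc.le⟩ : c ∈ Icc (δ 0) (δ u))
  have := hmin ⟨⟨hw.1, hw.2.trans (hu2.2.le.trans hs.2)⟩, hwc⟩
  linarith [hw.2, hu2.2]

/-- **Lemma (the term `A_k` vanishes).**
For a test function `ψ ∈ C_c^∞((0,T);ℝ^m)` there is `C > 0`, independent of
`k`, such that for every penalized solution `X^k` (with `k > ‖F‖_∞/ε`)
`|A_k| = |∫_{I_k} (d/dt d(x_i^k)) ∇d(x_i^k)·ψ dt| ≤ C T ‖F‖_∞ / k`;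
in particular `A_k → 0`. -/
theorem Ak_tendsto_zero {m n : ℕ} (Ω : Set (Pt m)) (ν : Pt m → Pt m)
    (hΩ : IsC2Domain Ω ν) (ε : ℝ) (hε : 0 < ε)
    (hd1 : ContDiffOn ℝ 2 (distCl Ω) (closure (Metric.thickening ε (frontier Ω)) \ Ω))
    (hd2 : ∀ x ∈ closure (Metric.thickening ε Ω) \ closure Ω,
      ContDiffAt ℝ 2 (distCl Ω) x)
    (T : ℝ) (hT : 0 < T) (F : Fin n → ℝ → Conf m n → Pt m)
    (hFc : ∀ i, Continuous (Function.uncurry (F i)))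
    (M : ℝ) (hM : ∀ i, ∀ t ∈ Icc (0:ℝ) T, ∀ X : Conf m n, ‖F i t X‖ ≤ M)
    (i : Fin n) (ψ : ℝ → Pt m) (hψ : ContDiff ℝ ∞ ψ)
    (hψc : HasCompactSupport ψ) (hψs : tsupport ψ ⊆ Ioo 0 T) :
    ∃ C > (0:ℝ), ∀ k : ℝ, M / ε < k → ∀ X0 ∈ Gset Ω n, ∀ Xk : ℝ → Conf m n,
      IsPenalSol Ω F T k X0 Xk →
      |∫ t in {t ∈ Icc (0:ℝ) T | Xk t i ∉ closure Ω},
          derivWithin (fun s => distCl Ω (Xk s i)) (Icc 0 T) t *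
            ⟪gradient (distCl Ω) (Xk t i), ψ t⟫| ≤ C * T * M / k := by
  have hne := hΩ.nonempty
  have hM0 : 0 ≤ M := (norm_nonneg _).trans (hM i 0 ⟨le_rfl, hT.le⟩ 0)
  obtain ⟨B, hB0, hB⟩ := hess_bound Ω hΩ.isOpen hΩ.bounded ε hε hd1 hd2
  obtain ⟨P0, hP0⟩ := hψc.exists_bound_of_continuous hψ.continuous
  have hψd : Continuous (deriv ψ) := hψ.continuous_deriv (by simp)
  obtain ⟨P1, hP1⟩ := hψc.deriv.exists_bound_of_continuous hψd
  have hP00 : 0 ≤ P0 := (norm_nonneg _).trans (hP0 0)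
  have hP10 : 0 ≤ P1 := (norm_nonneg _).trans (hP1 0)
  refine ⟨B * (2 * M) * P0 + P1 + 1, by positivity, ?_⟩
  intro k hk X0 hX0 Xk hX
  have hk0 : 0 < k := lt_of_le_of_lt (by positivity) hk
  have hMk : M / k < ε := by
    rw [div_lt_iff₀ hε] at hk
    rw [div_lt_iff₀ hk0]; linarith
  set d := distCl Ω with hd
  set x : ℝ → Pt m := fun t => Xk t i with hx
  set x' : ℝ → Pt m := fun t => F i t (Xk t) - k • dGradd Ω (x t) with hx'
  have hC2 : ∀ z ∈ Metric.thickening ε Ω, z ∉ closure Ω → ContDiffAt ℝ 2 d z :=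
    fun z hz hz' => hd2 z ⟨subset_closure hz, hz'⟩
  have hxd : ∀ t ∈ Icc (0:ℝ) T, HasDerivWithinAt x (x' t) (Icc 0 T) t := hX.2 i
  have hx0 : x 0 ∈ closure Ω := by
    rw [hx]; simp only [hX.1]; exact hX0 i
  have hδ := penal_bound Ω hne ε (fun z hz hz' => (hC2 z hz hz').differentiableAt (by norm_num))
    T k M hk0 hMk x (fun t => F i t (Xk t)) (fun t ht => hM i t ht _) hx0 hxd
  have hxc : ContinuousOn x (Icc 0 T) := fun t ht => (hxd t ht).continuousWithinAt
  have hXc : ContinuousOn Xk (Icc 0 T) :=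
    continuousOn_pi.2 fun j t ht => (hX.2 j t ht).continuousWithinAt
  -- the open set of times outside
  set J : Set ℝ := Ioo 0 T ∩ x ⁻¹' (closure Ω)ᶜ with hJ
  have hJo : IsOpen J := (hxc.mono Ioo_subset_Icc_self).isOpen_inter_preimage isOpen_Ioo
    isClosed_closure.isOpen_compl
  have hJI : J ⊆ Icc 0 T := fun t ht => Ioo_subset_Icc_self ht.1
  have hxJ : ∀ t ∈ J, x t ∈ Metric.thickening ε Ω ∧ x t ∉ closure Ω := fun t ht =>
    ⟨mem_thick Ω hne ε _ ((hδ t (hJI ht)).trans_lt hMk), ht.2⟩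
  have hxa : ∀ t ∈ Ioo 0 T, HasDerivAt x (x' t) t := fun t ht =>
    (hxd t (Ioo_subset_Icc_self ht)).hasDerivAt (Icc_mem_nhds ht.1 ht.2)
  have hC2J : ∀ t ∈ J, ContDiffAt ℝ 2 d (x t) := fun t ht => hC2 _ (hxJ t ht).1 (hxJ t ht).2
  have hdif : ∀ t ∈ J, HasFDerivAt d (fderiv ℝ d (x t)) (x t) := fun t ht =>
    ((hC2J t ht).differentiableAt (by norm_num)).hasFDerivAt
  have hC1J : ∀ t ∈ J, ContDiffAt ℝ 1 (fderiv ℝ d) (x t) := fun t ht =>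
    (hC2J t ht).fderiv_right (by norm_num)
  have hdif2 : ∀ t ∈ J, HasFDerivAt (fderiv ℝ d) (fderiv ℝ (fderiv ℝ d) (x t)) (x t) :=
    fun t ht => ((hC1J t ht).differentiableAt (by norm_num)).hasFDerivAt
  have hc2 : ∀ t ∈ J, ContinuousAt (fderiv ℝ (fderiv ℝ d)) (x t) := fun t ht =>
    ((hC1J t ht).fderiv_right (m := 0) (by norm_num)).continuousAt
  have hxcJ : ContinuousOn x J := hxc.mono hJI
  have hc1 : ContinuousOn (fun t => fderiv ℝ d (x t)) J := fun t ht =>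
    ((hdif2 t ht).continuousAt.comp_continuousWithinAt (hxcJ t ht))
  have hc2' : ContinuousOn (fun t => fderiv ℝ (fderiv ℝ d) (x t)) J := fun t ht =>
    ((hc2 t ht).comp_continuousWithinAt (hxcJ t ht))
  have hcg : ContinuousOn (fun t => gradient d (x t)) J := by
    exact (InnerProductSpace.toDual ℝ (Pt m)).symm.continuous.comp_continuousOn hc1
  have hcd : Continuous d := (distCl_lip Ω).continuous
  have hx'c : ContinuousOn x' J := by
    have h1 : ContinuousOn (fun t => F i t (Xk t)) J :=
      (hFc i).comp_continuousOn (continuousOn_id.prodMk (hXc.mono hJI))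
    have h2 : ContinuousOn (fun t => F i t (Xk t) - k • (d (x t) • gradient d (x t))) J :=
      h1.sub (((hcd.comp_continuousOn hxcJ).smul hcg).const_smul k)
    refine h2.congr fun t ht => ?_
    simp only [hx', dGradd, if_neg (hxJ t ht).2, hd]
  have hx'b : ∀ t ∈ J, ‖x' t‖ ≤ 2 * M := by
    intro t ht
    have h1 : ‖F i t (Xk t)‖ ≤ M := hM i t (hJI ht) _
    have h2 : ‖k • dGradd Ω (x t)‖ ≤ M := by
      rw [dGradd, if_neg (hxJ t ht).2, norm_smul, norm_smul, norm_gradient_eq,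
        Real.norm_of_nonneg hk0.le, Real.norm_of_nonneg (distCl_nonneg Ω (x t))]
      have h3 := hδ t (hJI ht)
      have h4 := norm_fderiv_distCl_le Ω (x t)
      calc _ ≤ k * (M / k * 1) := by gcongr
        _ = M := by field_simp
    calc _ ≤ ‖F i t (Xk t)‖ + ‖k • dGradd Ω (x t)‖ := norm_sub_le _ _
      _ ≤ _ := by linarith
  -- reduce to the integral over `J`
  have hset : ({t ∈ Icc (0:ℝ) T | Xk t i ∉ closure Ω} : Set ℝ) =ᵐ[volume] J := by
    have h1 : ({t ∈ Icc (0:ℝ) T | Xk t i ∉ closure Ω} : Set ℝ)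
        = Icc 0 T ∩ x ⁻¹' (closure Ω)ᶜ := rfl
    rw [h1, hJ]
    exact Ioo_ae_eq_Icc.symm.inter (ae_eq_refl _)
  rw [setIntegral_congr_set hset]
  have hδd : ∀ t ∈ J, HasDerivAt (fun s => d (x s)) (fderiv ℝ d (x t) (x' t)) t := fun t ht =>
    (hdif t ht).comp_hasDerivAt t (hxa t ht.1)
  have hcongr : ∫ t in J, derivWithin (fun s => d (Xk s i)) (Icc 0 T) t * ⟪gradient d (Xk t i), ψ t⟫
      = ∫ t in J, fderiv ℝ d (x t) (x' t) * fderiv ℝ d (x t) (ψ t) := by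
    refine setIntegral_congr_fun hJo.measurableSet fun t ht => ?_
    rw [inner_gradient_eq]
    congr 1
    exact ((hδd t ht).hasDerivWithinAt).derivWithin ((uniqueDiffOn_Icc hT) t (hJI ht))
  rw [hcongr]
  have hnotin : ∀ a, a ∉ Ioo 0 T → (fun t => fderiv ℝ d (x t) (ψ t)) =ᶠ[𝓝 a] 0 := by
    intro a ha
    have : ψ =ᶠ[𝓝 a] 0 := notMem_tsupport_iff_eventuallyEq.1 fun h => ha (hψs h)
    filter_upwards [this] with t ht
    simp [ht]
  have hψ' : ∀ t, HasDerivAt ψ (deriv ψ t) t := fun t =>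
    (hψ.differentiable (by simp) t).hasDerivAt
  have hfin := core_ibp T hT J hJo inter_subset_left (fun t => d (x t))
    (fun t => fderiv ℝ d (x t) (x' t)) (fun t => fderiv ℝ d (x t) (ψ t))
    (fun t => fderiv ℝ (fderiv ℝ d) (x t) (x' t) (ψ t) + fderiv ℝ d (x t) (deriv ψ t))
    (M / k) (2 * M) P0 (B * (2 * M) * P0 + P1) (by positivity) (by positivity)
    (fun t => Metric.infDist_nonneg) (fun t ht => (distCl_pos Ω hne _).2 (hxJ t ht).2)
    (fun t ht => hδ t (hJI ht)) hδd
    (fun t ht => ((hdif2 t ht).comp_hasDerivAt t (hxa t ht.1)).clm_apply (hψ' t))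
    (hc1.clm_apply hx'c)
    (((hc2'.clm_apply hx'c).clm_apply hψ.continuous.continuousOn).add
      (hc1.clm_apply hψd.continuousOn))
    (fun t ht => by
      have h1 := (fderiv ℝ d (x t)).le_of_opNorm_le (norm_fderiv_distCl_le Ω (x t)) (x' t)
      rw [Real.norm_eq_abs] at h1
      linarith [hx'b t ht])
    (fun t => by
      have h1 := (fderiv ℝ d (x t)).le_of_opNorm_le (norm_fderiv_distCl_le Ω (x t)) (ψ t)
      rw [Real.norm_eq_abs] at h1
      linarith [hP0 t])
    (fun t ht => by
      have h1 := (fderiv ℝ d (x t)).le_of_opNorm_le (norm_fderiv_distCl_le Ω (x t)) (deriv ψ t)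
      have h2 := (fderiv ℝ (fderiv ℝ d) (x t)).le_of_opNorm_le_of_le
        (hB _ (hxJ t ht).1 (hxJ t ht).2) (hx'b t ht)
      have h3 := (fderiv ℝ (fderiv ℝ d) (x t) (x' t)).le_of_opNorm_le_of_le h2 (hP0 t)
      rw [Real.norm_eq_abs] at h1 h3
      refine (abs_add_le _ _).trans ?_
      linarith [hP1 t])
    (fun t ht htJ => by
      have hcl : x t ∈ closure Ω := by
        by_contra h; exact htJ ⟨ht, h⟩
      refine ⟨Metric.infDist_zero_of_mem hcl, ?_⟩
      refine Asymptotics.IsBigO.trans ?_ (hxa t ht).isBigO_sub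
      refine Asymptotics.IsBigO.of_bound 1 (Eventually.of_forall fun s => ?_)
      rw [Real.norm_of_nonneg (distCl_nonneg Ω (x s)), one_mul, ← dist_eq_norm]
      exact Metric.infDist_le_dist_of_mem hcl)
    (hnotin 0 (by simp)) (hnotin T (by simp))
  refine hfin.trans ?_
  calc T * (M / k) * (B * (2 * M) * P0 + P1) ≤ T * (M / k) * (B * (2 * M) * P0 + P1 + 1) := by
        refine mul_le_mul_of_nonneg_left (by linarith) (by positivity)
    _ = _ := by ring
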